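/- arXiv:1704.06900 — 2 statements merged into one kernel-verified Lean document; each statement's English description precedes it below -/
import Mathlib

section
/- Consider a time-varying FJ model and for each k ≥ 0 the (n+1)×(n+1) augmented matrix Â(k) whose upper-left n×n block is Λ(k)W(k), whose last column's first n entries are the entries of (I − Λ(k))𝟏, whose last row is (0,…,0,1). Suppose there exists ε > 0 such that for every k ≥ 0 every entry of Â(k) lies in {0} ∪ [ε, 1] and every diagonal entry of Â(k) is at least ε. If there exists an integer T ≥ 1 such that for every k ≥ 0, in the graph of the matrix Â(k) + Â(k+1) + … + Â(k+T−1) every node is connected to node n+1 by a walk, then the time-varying FJ model is asymptotically stable, i.e. the product Λ(k)W(k)⋯Λ(0)W(0) tends to the zero matrix as k → ∞. -/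
open Filter

/-- The backward matrix product `Λ(k)W(k)·Λ(k−1)W(k−1)⋯Λ(0)W(0)`. -/
noncomputable def prodA {n : ℕ} (lam : ℕ → Fin n → ℝ)
    (W : ℕ → Matrix (Fin n) (Fin n) ℝ) : ℕ → Matrix (Fin n) (Fin n) ℝ
  | 0 => Matrix.diagonal (lam 0) * W 0
  | k + 1 => (Matrix.diagonal (lam (k + 1)) * W (k + 1)) * prodA lam W k

/-- The `(n+1)×(n+1)` augmented matrix `Â(k)`: upper-left `n×n` block `Λ(k)W(k)`,
last column's first `n` entries given by `(I − Λ(k))𝟏`, last row `(0,…,0,1)`. -/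
noncomputable def hatA {n : ℕ} (lam : ℕ → Fin n → ℝ)
    (W : ℕ → Matrix (Fin n) (Fin n) ℝ) (k : ℕ) :
    Matrix (Fin (n + 1)) (Fin (n + 1)) ℝ :=
  Matrix.of fun i j =>
    if hi : (i : ℕ) < n then
      if hj : (j : ℕ) < n then (Matrix.diagonal (lam k) * W k) ⟨i, hi⟩ ⟨j, hj⟩
      else 1 - lam k ⟨i, hi⟩
    else if (j : ℕ) < n then 0 else 1

/-- A row-stochastic row cannot exceed an upper bound of the entries it averages. -/
lemma mulVec_le_of_le {V : Type*} [Fintype V] {B : Matrix V V ℝ} (hB0 : ∀ i j, 0 ≤ B i j)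
    (hB1 : ∀ i, ∑ j, B i j = 1) {x : V → ℝ} {M : ℝ} (hx : ∀ i, x i ≤ M) (i : V) :
    (B.mulVec x) i ≤ M := by
  calc (B.mulVec x) i = ∑ j, B i j * x j := rfl
    _ ≤ ∑ j, B i j * M :=
        Finset.sum_le_sum fun j _ => mul_le_mul_of_nonneg_left (hx j) (hB0 i j)
    _ = M := by rw [← Finset.sum_mul, hB1, one_mul]

/-- A relative deficit `p` at `j` is transmitted to `i` up to the factor `ε ≤ B i j`. -/
lemma mulVec_le_of_deficit {V : Type*} [Fintype V] {B : Matrix V V ℝ}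
    (hB0 : ∀ i j, 0 ≤ B i j) (hB1 : ∀ i, ∑ j, B i j = 1) {x : V → ℝ} {M p ε : ℝ}
    (hM : 0 ≤ M) (hp : 0 ≤ p) (hx : ∀ i, x i ≤ M) {i j : V} (hε : ε ≤ B i j)
    (hj : x j ≤ M * (1 - p)) :
    (B.mulVec x) i ≤ M * (1 - ε * p) := by
  have hsum : M - (B.mulVec x) i = ∑ l, B i l * (M - x l) := by
    simp only [mul_sub, Finset.sum_sub_distrib, ← Finset.sum_mul, hB1, one_mul]
    rfl
  have hle : B i j * (M - x j) ≤ ∑ l, B i l * (M - x l) :=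
    Finset.single_le_sum (f := fun l => B i l * (M - x l))
      (fun l _ => mul_nonneg (hB0 i l) (sub_nonneg.2 (hx l))) (Finset.mem_univ j)
  have h1 : ε * (M * p) ≤ B i j * (M - x j) :=
    mul_le_mul hε (by linarith) (mul_nonneg hM hp) (hB0 i j)
  linarith

/-- A walk leaving the complement of `S` and ending in `S` crosses the boundary of `S`. -/
lemma exists_crossing {V : Type*} {R : V → V → Prop} {S : Set V} {i r : V}
    (h : Relation.ReflTransGen R i r) (hi : i ∉ S) (hr : r ∈ S) :
    ∃ a b, a ∉ S ∧ b ∈ S ∧ R a b := by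
  induction h using Relation.ReflTransGen.head_induction_on with
  | refl => exact absurd hr hi
  | @head a b hab _ ih =>
    by_cases hb : b ∈ S
    · exact ⟨a, b, hi, hb, hab⟩
    · exact ih hb

/-- Uniform contraction, over `card V` windows of length `T`, of an averaging dynamics
vanishing at a node `r` that is reachable from every node in each window. -/
lemma contraction_of_connectivity {V : Type*} [Fintype V] {B : ℕ → Matrix V V ℝ}
    (hB0 : ∀ k i j, 0 ≤ B k i j) (hB1 : ∀ k i, ∑ j, B k i j = 1) {ε : ℝ} (hε : 0 < ε)
    (hε1 : ε ≤ 1)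
    (hpos : ∀ k i j, 0 < B k i j → ε ≤ B k i j) (hdiag : ∀ k i, ε ≤ B k i i) {T : ℕ} {r : V}
    (hconn : ∀ k i, Relation.ReflTransGen
      (fun a b => 0 < (∑ t ∈ Finset.range T, B (k + t)) a b) i r)
    {z : ℕ → V → ℝ} (hz : ∀ k, z (k + 1) = (B k).mulVec (z k)) (hr : ∀ k, z k r = 0)
    {M : ℝ} (hM : 0 ≤ M) (hzM : ∀ i, z 0 i ≤ M) (i : V) :
    z (Fintype.card V * T) i ≤ M * (1 - ε ^ (Fintype.card V * T)) := by
  classical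
  have hle : ∀ k i, z k i ≤ M := by
    intro k
    induction k with
    | zero => exact hzM
    | succ k ih => rw [hz]; exact mulVec_le_of_le (hB0 k) (hB1 k) ih
  let S : ℕ → Finset V := fun m => Finset.univ.filter fun i => z m i ≤ M * (1 - ε ^ m)
  have hmem : ∀ m i, i ∈ S m ↔ z m i ≤ M * (1 - ε ^ m) := by simp [S]
  have hstep : ∀ m i j, ε ≤ B m i j → j ∈ S m → i ∈ S (m + 1) := by
    intro m i j hij hj
    rw [hmem] at hj ⊢
    rw [hz, pow_succ']
    exact mulVec_le_of_deficit (hB0 m) (hB1 m) hM (by positivity) (hle m) hij hj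
  have hmono : Monotone S := monotone_nat_of_le_succ fun m i hi => hstep m i i (hdiag m i) hi
  have hrS : ∀ m, r ∈ S m := by
    intro m
    rw [hmem, hr]
    exact mul_nonneg hM (sub_nonneg.2 (pow_le_one₀ hε.le hε1))
  have hgrow : ∀ m, S m ≠ Finset.univ → (S m).card < (S (m + T)).card := by
    intro m hm
    obtain ⟨i, hi⟩ : ∃ i, i ∉ S m := by
      by_contra! h
      exact hm (Finset.eq_univ_iff_forall.2 h)
    obtain ⟨a, b, ha, hb, hab⟩ :=
      exists_crossing (S := (S m : Set V)) (hconn m i) (by simpa using hi) (by simpa using hrS m)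
    rw [Matrix.sum_apply] at hab
    obtain ⟨t, ht, hpt⟩ := Finset.exists_lt_of_sum_lt (f := fun _ => (0 : ℝ)) (by simpa using hab)
    have haS : a ∈ S (m + t + 1) :=
      hstep _ a b (hpos _ _ _ hpt) (hmono (Nat.le_add_right m t) (by simpa using hb))
    have haT : a ∈ S (m + T) := hmono (by have := Finset.mem_range.1 ht; omega) haS
    refine Finset.card_lt_card ((Finset.ssubset_iff_of_subset (hmono (by omega))).2 ?_)
    exact ⟨a, haT, by simpa using ha⟩
  have hcard : ∀ j, j ≤ (S (j * T)).card ∨ S (j * T) = Finset.univ := by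
    intro j
    induction j with
    | zero => left; simp
    | succ j ih =>
      rw [Nat.succ_mul]
      by_cases hu : S (j * T) = Finset.univ
      · right
        exact Finset.univ_subset_iff.1 (hu ▸ hmono (Nat.le_add_right (j * T) T))
      · left
        have := hgrow _ hu
        have := ih.resolve_right hu
        omega
  have huniv : S (Fintype.card V * T) = Finset.univ := by
    rcases hcard (Fintype.card V) with h | h
    · exact (Finset.card_eq_iff_eq_univ _).1 (le_antisymm (Finset.card_le_univ _) h)
    · exact h
  exact (hmem _ i).1 (huniv ▸ Finset.mem_univ i)

/-- Nonnegative averaging dynamics anchored at zero at a node reachable from every node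
in each window of length `T` converges to zero. -/
lemma tendsto_zero_of_connectivity {V : Type*} [Fintype V] {B : ℕ → Matrix V V ℝ}
    (hB0 : ∀ k i j, 0 ≤ B k i j) (hB1 : ∀ k i, ∑ j, B k i j = 1) {ε : ℝ} (hε : 0 < ε)
    (hε1 : ε ≤ 1)
    (hpos : ∀ k i j, 0 < B k i j → ε ≤ B k i j) (hdiag : ∀ k i, ε ≤ B k i i)
    {T : ℕ} (hT : 1 ≤ T) {r : V}
    (hconn : ∀ k i, Relation.ReflTransGen
      (fun a b => 0 < (∑ t ∈ Finset.range T, B (k + t)) a b) i r)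
    {z : ℕ → V → ℝ} (hz : ∀ k, z (k + 1) = (B k).mulVec (z k)) (hr : ∀ k, z k r = 0)
    (hz0 : ∀ k i, 0 ≤ z k i) (hz1 : ∀ i, z 0 i ≤ 1) (i : V) :
    Tendsto (fun k => z k i) atTop (nhds 0) := by
  set N := Fintype.card V * T with hN
  have hNpos : 0 < N := Nat.mul_pos (Fintype.card_pos_iff.2 ⟨r⟩) hT
  have hδ0 : 0 ≤ 1 - ε ^ N := sub_nonneg.2 (pow_le_one₀ hε.le hε1)
  have hδ1 : 1 - ε ^ N < 1 := by linarith [pow_pos hε N]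
  have hwin : ∀ q i, z (q * N) i ≤ (1 - ε ^ N) ^ q := by
    intro q
    induction q with
    | zero => simpa using hz1
    | succ q ih =>
      intro i
      have := contraction_of_connectivity (B := fun k => B (q * N + k))
        (z := fun k => z (q * N + k)) (r := r) (T := T) (fun k => hB0 _) (fun k => hB1 _) hε hε1
        (fun k => hpos _) (fun k => hdiag _)
        (fun k i => by simpa only [add_assoc] using hconn (q * N + k) i)
        (fun k => hz _) (fun k => hr _) (pow_nonneg hδ0 q) ih i
      rwa [Nat.succ_mul, pow_succ]
  have hall : ∀ q t i, z (q * N + t) i ≤ (1 - ε ^ N) ^ q := by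
    intro q t
    induction t with
    | zero => exact hwin q
    | succ t ih =>
      rw [← add_assoc, hz]
      exact mulVec_le_of_le (hB0 _) (hB1 _) ih
  refine squeeze_zero (fun k => hz0 k i) (fun k => ?_)
    ((tendsto_pow_atTop_nhds_zero_of_lt_one hδ0 hδ1).comp
      (Nat.tendsto_div_const_atTop hNpos.ne'))
  have := hall (k / N) (k % N) i
  rwa [Nat.div_add_mod'] at this

section hatA

variable {n : ℕ} (lam : ℕ → Fin n → ℝ) (W : ℕ → Matrix (Fin n) (Fin n) ℝ) (k : ℕ)

lemma hatA_castSucc_castSucc (i j : Fin n) :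
    hatA lam W k i.castSucc j.castSucc = (Matrix.diagonal (lam k) * W k) i j := by
  simp [hatA]

lemma hatA_castSucc_last (i : Fin n) :
    hatA lam W k i.castSucc (Fin.last n) = 1 - lam k i := by
  simp [hatA]

lemma hatA_last_castSucc (j : Fin n) : hatA lam W k (Fin.last n) j.castSucc = 0 := by
  simp [hatA]

lemma hatA_last_last : hatA lam W k (Fin.last n) (Fin.last n) = 1 := by
  simp [hatA]

variable {W} in
lemma sum_hatA (hW1 : ∀ k i, ∑ j, W k i j = 1) (i : Fin (n + 1)) :
    ∑ j, hatA lam W k i j = 1 := by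
  rw [Fin.sum_univ_castSucc]
  induction i using Fin.lastCases with
  | last => simp [hatA_last_castSucc, hatA_last_last]
  | cast i =>
    simp [hatA_castSucc_castSucc, hatA_castSucc_last, Matrix.diagonal_mul, ← Finset.mul_sum, hW1]

/-- The row sums of the products `prodA`, extended by `0` in the last coordinate and
starting from the all-ones vector. -/
noncomputable def augmentedRowSums : ℕ → Fin (n + 1) → ℝ
  | 0 => Fin.snoc (α := fun _ => ℝ) (fun _ => 1) 0
  | k + 1 => Fin.snoc (α := fun _ => ℝ) (fun i => ∑ j, prodA lam W k i j) 0

lemma augmentedRowSums_last : augmentedRowSums lam W k (Fin.last n) = 0 := by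
  cases k <;> simp [augmentedRowSums]

lemma augmentedRowSums_succ :
    augmentedRowSums lam W (k + 1) = (hatA lam W k).mulVec (augmentedRowSums lam W k) := by
  ext i
  simp only [Matrix.mulVec, dotProduct]
  rw [Fin.sum_univ_castSucc, augmentedRowSums_last]
  induction i using Fin.lastCases with
  | last => simp [hatA_last_castSucc, augmentedRowSums_last]
  | cast i =>
    cases k with
    | zero => simp [augmentedRowSums, hatA_castSucc_castSucc, prodA]
    | succ k =>
      simp only [augmentedRowSums, hatA_castSucc_castSucc, Fin.snoc_castSucc, prodA,
        Matrix.mul_apply (M := Matrix.diagonal (lam (k + 1)) * W (k + 1)), Finset.mul_sum,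
        mul_zero, add_zero]
      exact Finset.sum_comm

variable {lam W} in
lemma prodA_nonneg (hW0 : ∀ k i j, 0 ≤ W k i j) (hlam : ∀ k i, 0 ≤ lam k i) (i j : Fin n) :
    0 ≤ prodA lam W k i j := by
  have hA : ∀ k i j, 0 ≤ (Matrix.diagonal (lam k) * W k) i j := fun k i j => by
    rw [Matrix.diagonal_mul]
    exact mul_nonneg (hlam k i) (hW0 k i j)
  induction k generalizing i with
  | zero => exact hA 0 i j
  | succ k ih =>
    rw [prodA, Matrix.mul_apply]
    exact Finset.sum_nonneg fun l _ => mul_nonneg (hA _ i l) (ih l)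

end hatA

/-- Lemma 4: suppose `ε > 0` is such that every entry of `Â(k)` lies in `{0} ∪ [ε, 1]`
and every diagonal entry of `Â(k)` is at least `ε`. If for some period `T ≥ 1`, for every
`k` each node is connected to node `n+1` by a walk in the graph of
`Â(k) + ⋯ + Â(k+T−1)`, then the time-varying FJ model is asymptotically stable, i.e.
`Λ(k)W(k)⋯Λ(0)W(0) → 0`. -/
theorem stability_of_periodic_connectivity {n : ℕ}
    (lam : ℕ → Fin n → ℝ) (W : ℕ → Matrix (Fin n) (Fin n) ℝ)
    (hW0 : ∀ k i j, 0 ≤ W k i j) (hW1 : ∀ k i, ∑ j, W k i j = 1)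
    (hlam : ∀ k i, 0 ≤ lam k i ∧ lam k i ≤ 1)
    (ε : ℝ) (hε : 0 < ε)
    (hentries : ∀ k (i j : Fin (n + 1)),
      hatA lam W k i j = 0 ∨ (ε ≤ hatA lam W k i j ∧ hatA lam W k i j ≤ 1))
    (hdiag : ∀ k (i : Fin (n + 1)), ε ≤ hatA lam W k i i)
    (T : ℕ) (hT : 1 ≤ T)
    (hconn : ∀ k : ℕ, ∀ i : Fin (n + 1),
      Relation.ReflTransGen
        (fun a b => 0 < (∑ t ∈ Finset.range T, hatA lam W (k + t)) a b)
        i (Fin.last n)) :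
    Tendsto (prodA lam W) atTop (nhds 0) := by
  have hε1 : ε ≤ 1 := hatA_last_last lam W 0 ▸ hdiag 0 (Fin.last n)
  have hP0 : ∀ k i j, 0 ≤ prodA lam W k i j :=
    fun k => prodA_nonneg k hW0 fun k i => (hlam k i).1
  have hz0 : ∀ k i, 0 ≤ augmentedRowSums lam W k i := by
    intro k i
    induction i using Fin.lastCases with
    | last => rw [augmentedRowSums_last]
    | cast i =>
      cases k with
      | zero => simp [augmentedRowSums]
      | succ k => simpa [augmentedRowSums] using Finset.sum_nonneg fun j _ => hP0 k i j
  have hz1 : ∀ i, augmentedRowSums lam W 0 i ≤ 1 := by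
    intro i
    induction i using Fin.lastCases <;> simp [augmentedRowSums]
  have hB0 : ∀ k i j, 0 ≤ hatA lam W k i j := fun k i j =>
    (hentries k i j).elim (fun h => h.ge) fun h => hε.le.trans h.1
  have hpos : ∀ k i j, 0 < hatA lam W k i j → ε ≤ hatA lam W k i j := fun k i j h =>
    (hentries k i j).elim (fun h0 => absurd h0 h.ne') fun h => h.1
  have hlim := tendsto_zero_of_connectivity hB0 (fun k => sum_hatA lam k hW1) hε hε1 hpos hdiag
    hT hconn (augmentedRowSums_succ lam W) (augmentedRowSums_last lam W) hz0 hz1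
  refine tendsto_pi_nhds.2 fun i => tendsto_pi_nhds.2 fun j => ?_
  refine squeeze_zero (fun k => hP0 k i j) (fun k => ?_)
    ((hlim i.castSucc).comp (tendsto_add_atTop_nat 1))
  simpa [augmentedRowSums] using
    Finset.single_le_sum (f := fun j => prodA lam W k i j) (fun l _ => hP0 k i l)
      (Finset.mem_univ j)
end

section
/- Let (Λ, W) be an FJ model, δ, ε > 0, A = ΛW, and d(i) = d_ε(i, S_Λ^δ, W). For every integer m ≥ 0 and every node i with d(i) ≤ m, the deficiency of the i-th row of the matrix A^{1+m} is at least δ ε^{d(i)}, i.e. 1 − Σ_j (A^{1+m})_{ij} ≥ δ ε^{d(i)}. -/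
/-- `hasWalk W ε S i r` : there exists an ε-walk of length `r` in the graph of `W`
from node `i` to the set `S` (length 0 meaning `i ∈ S`). -/
def hasWalk {n : ℕ} (W : Matrix (Fin n) (Fin n) ℝ) (ε : ℝ) (S : Set (Fin n))
    (i : Fin n) (r : ℕ) : Prop :=
  ∃ p : ℕ → Fin n, p 0 = i ∧ p r ∈ S ∧ ∀ k < r, ε ≤ W (p k) (p (k + 1))

/-- Row sums of `(ΛW) ^ (k + 1)` in terms of those of `(ΛW) ^ k`. -/
theorem sum_diagonal_mul_pow_succ {n : ℕ} (lam : Fin n → ℝ) (W : Matrix (Fin n) (Fin n) ℝ)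
    (k : ℕ) (i : Fin n) :
    ∑ j, ((Matrix.diagonal lam * W) ^ (k + 1)) i j =
      lam i * ∑ l, W i l * ∑ j, ((Matrix.diagonal lam * W) ^ k) l j := by
  simp only [pow_succ', Matrix.mul_assoc (Matrix.diagonal lam), Matrix.diagonal_mul]
  rw [← Finset.mul_sum]
  simp only [Matrix.mul_apply (M := W), Finset.mul_sum]
  rw [Finset.sum_comm]

/-- Row sums of the powers of `ΛW` lie in `[0, 1]`. -/
theorem sum_diagonal_mul_pow_mem_Icc {n : ℕ} {lam : Fin n → ℝ} {W : Matrix (Fin n) (Fin n) ℝ}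
    (hW0 : ∀ i j, 0 ≤ W i j) (hW1 : ∀ i, ∑ j, W i j = 1)
    (hlam : ∀ i, 0 ≤ lam i ∧ lam i ≤ 1) (k : ℕ) (i : Fin n) :
    ∑ j, ((Matrix.diagonal lam * W) ^ k) i j ∈ Set.Icc (0 : ℝ) 1 := by
  induction k generalizing i with
  | zero => simp [Matrix.one_apply]
  | succ k ih =>
    rw [sum_diagonal_mul_pow_succ]
    have h0 : 0 ≤ ∑ l, W i l * ∑ j, ((Matrix.diagonal lam * W) ^ k) l j :=
      Finset.sum_nonneg fun l _ => mul_nonneg (hW0 i l) (ih l).1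
    have h1 : ∑ l, W i l * ∑ j, ((Matrix.diagonal lam * W) ^ k) l j ≤ 1 :=
      (Finset.sum_le_sum fun l _ => mul_le_of_le_one_right (hW0 i l) (ih l).2).trans (hW1 i).le
    exact ⟨mul_nonneg (hlam i).1 h0, mul_le_one₀ (hlam i).2 h0 h1⟩

/-- The deficiency bound along an arbitrary, not necessarily shortest, ε-walk. -/
theorem deficiency_ge_of_hasWalk {n : ℕ} {lam : Fin n → ℝ} {W : Matrix (Fin n) (Fin n) ℝ}
    (hW0 : ∀ i j, 0 ≤ W i j) (hW1 : ∀ i, ∑ j, W i j = 1)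
    (hlam : ∀ i, 0 ≤ lam i ∧ lam i ≤ 1) {δ ε : ℝ} (hδ : 0 ≤ δ) (hε : 0 ≤ ε)
    {m d : ℕ} {i : Fin n} (hwalk : hasWalk W ε {j : Fin n | lam j ≤ 1 - δ} i d) (hdm : d ≤ m) :
    δ * ε ^ d ≤ 1 - ∑ j, ((Matrix.diagonal lam * W) ^ (m + 1)) i j := by
  have hs := sum_diagonal_mul_pow_mem_Icc hW0 hW1 hlam
  induction d generalizing m i with
  | zero =>
    obtain ⟨p, rfl, hp, -⟩ := hwalk
    have hp : lam (p 0) ≤ 1 - δ := hp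
    rw [sum_diagonal_mul_pow_succ]
    have h1 : ∑ l, W (p 0) l * ∑ j, ((Matrix.diagonal lam * W) ^ m) l j ≤ 1 :=
      (Finset.sum_le_sum fun l _ =>
        mul_le_of_le_one_right (hW0 _ l) (hs m l).2).trans (hW1 _).le
    have := mul_le_of_le_one_right (hlam (p 0)).1 h1
    linarith [pow_zero ε, mul_one δ]
  | succ d ih =>
    obtain ⟨p, rfl, hp, hstep⟩ := hwalk
    obtain ⟨m, rfl⟩ : ∃ k, m = k + 1 := ⟨m - 1, by omega⟩
    have hnext := ih (m := m) (i := p 1)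
      ⟨fun k => p (k + 1), rfl, hp, fun k hk => hstep (k + 1) (by omega)⟩ (by omega)
    rw [sum_diagonal_mul_pow_succ]
    set s : Fin n → ℝ := fun l => ∑ j, ((Matrix.diagonal lam * W) ^ (m + 1)) l j
    have h0 : 0 ≤ ∑ l, W (p 0) l * s l :=
      Finset.sum_nonneg fun l _ => mul_nonneg (hW0 _ l) (hs _ l).1
    calc δ * ε ^ (d + 1) = ε * (δ * ε ^ d) := by ring
      _ ≤ W (p 0) (p 1) * (1 - s (p 1)) :=
        mul_le_mul (hstep 0 d.succ_pos) hnext (by positivity) (hW0 _ _)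
      _ ≤ ∑ l, W (p 0) l * (1 - s l) :=
        Finset.single_le_sum (f := fun l => W (p 0) l * (1 - s l))
          (fun l _ => mul_nonneg (hW0 _ l) (sub_nonneg.2 (hs _ l).2)) (Finset.mem_univ _)
      _ = 1 - ∑ l, W (p 0) l * s l := by
        simp only [mul_sub, mul_one, Finset.sum_sub_distrib, hW1]
      _ ≤ 1 - lam (p 0) * ∑ l, W (p 0) l * s l :=
        sub_le_sub_left (mul_le_of_le_one_left h0 (hlam _).2) 1

/-- The key step in the proof of Theorem 2: for an FJ model `(Λ, W)`, `δ, ε > 0`,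
`A = ΛW` and any node `i` whose ε-distance `d(i) = d_ε(i, S_Λ^δ, W)` (the length `d` of a
shortest ε-walk from `i` to `S_Λ^δ = {j : λ_jj ≤ 1 − δ}`) satisfies `d(i) ≤ m`,
the deficiency of the `i`-th row of `A^{1+m}` is at least `δ ε^{d(i)}`. -/
theorem deficiency_ge_of_dist_le {n : ℕ}
    (lam : Fin n → ℝ) (W : Matrix (Fin n) (Fin n) ℝ)
    (hW0 : ∀ i j, 0 ≤ W i j) (hW1 : ∀ i, ∑ j, W i j = 1)
    (hlam : ∀ i, 0 ≤ lam i ∧ lam i ≤ 1)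
    (δ ε : ℝ) (hδ : 0 < δ) (hε : 0 < ε)
    (m : ℕ) (i : Fin n) (d : ℕ)
    (hwalk : hasWalk W ε {j : Fin n | lam j ≤ 1 - δ} i d)
    (hshortest : ∀ r < d, ¬ hasWalk W ε {j : Fin n | lam j ≤ 1 - δ} i r)
    (hdm : d ≤ m) :
    δ * ε ^ d ≤ 1 - ∑ j, ((Matrix.diagonal lam * W) ^ (1 + m)) i j := by
  rw [add_comm 1 m]
  exact deficiency_ge_of_hasWalk hW0 hW1 hlam hδ.le hε.le hwalk hdm
end
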